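/- Let A, B, C, B', C' be points in the Euclidean plane ℝ², let δ ≥ 0 and D ≥ 0, and suppose dist(B,B') ≤ δ, dist(C,C') ≤ δ, and the diameter of conv{A,B,C} is at most D. Then the Lebesgue measure (area) of the symmetric difference of the closed triangles conv{A,B,C} and conv{A,B',C'} is at most 2δD + δ². -/

import Mathlib

open MeasureTheory Metric

section ConvexHull

variable {E : Type*} [AddCommGroup E] [Module ℝ E]

theorem mem_convexHull_triple_iff {x P Q R : E} :
    x ∈ convexHull ℝ {P, Q, R} ↔
      ∃ a b c : ℝ, 0 ≤ a ∧ 0 ≤ b ∧ 0 ≤ c ∧ a + b + c = 1 ∧ a • P + b • Q + c • R = x := by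
  constructor
  · rw [convexHull_insert ⟨Q, by simp⟩, convexHull_pair, mem_convexJoin]
    rintro ⟨p, rfl, q, ⟨s, t, hs, ht, hst, rfl⟩, u, v, hu, hv, huv, rfl⟩
    refine ⟨u, v * s, v * t, hu, by positivity, by positivity, ?_, ?_⟩
    · rw [add_assoc, ← mul_add, hst, mul_one, huv]
    · module
  · rintro ⟨a, b, c, ha, hb, hc, habc, rfl⟩
    refine mem_convexHull_of_exists_fintype ![a, b, c] ![P, Q, R] ?_ ?_ ?_ ?_
    · simp [Fin.forall_fin_succ, ha, hb, hc]
    · simpa [Fin.sum_univ_three] using habc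
    · simp [Fin.forall_fin_succ]
    · simp [Fin.sum_univ_three]

/-- In the plane, each face of a (degenerate) tetrahedron is covered by the other three. -/
theorem convexHull_triple_subset_union (hE : Module.finrank ℝ E = 2) (P Q R S : E) :
    convexHull ℝ {P, Q, S} ⊆
      convexHull ℝ {P, Q, R} ∪ (convexHull ℝ {P, R, S} ∪ convexHull ℝ {Q, R, S}) := by
  have : Module.Finite ℝ E := Module.finite_of_finrank_pos (by omega)
  intro x hx
  obtain ⟨a, b, c, ha, hb, hc, habc, rfl⟩ := mem_convexHull_triple_iff.1 hx
  have hdep : ¬ LinearIndependent ℝ ![P - R, Q - R, S - R] := by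
    intro h
    have := h.fintype_card_le_finrank
    simp [hE] at this
  obtain ⟨g, hg0, i, hi⟩ := Fintype.not_linearIndependent_iff.1 hdep
  wlog hsum : g 0 + g 1 + g 2 ≤ 0 generalizing g
  · refine this (-g) ?_ ?_ ?_
    · simp only [Pi.neg_apply, neg_smul, Finset.sum_neg_distrib, hg0, neg_zero]
    · simpa using hi
    · simp only [Pi.neg_apply]; linarith
  simp only [Fin.sum_univ_three, Matrix.cons_val] at hg0
  have hneg : ∃ j, g j < 0 := by
    by_contra! h
    have h0 := h 0
    have h1 := h 1
    have h2 := h 2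
    fin_cases i <;> refine hi (le_antisymm ?_ (h _)) <;>
      simp only [Fin.reduceFinMk, Fin.zero_eta, Fin.mk_one] <;> linarith
  obtain ⟨j, hj, hmin⟩ := Finset.exists_min_image (Finset.univ.filter fun j => g j < 0)
    (fun j => ![a, b, c] j / (-g j)) (by simpa [Finset.Nonempty] using hneg)
  simp only [Finset.mem_filter, Finset.mem_univ, true_and] at hj hmin
  set t := ![a, b, c] j / (-g j) with ht
  have hpos : ∀ k, 0 ≤ ![a, b, c] k := by simp [Fin.forall_fin_succ, ha, hb, hc]
  have ht0 : 0 ≤ t := div_nonneg (hpos j) (by linarith)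
  have hnn : ∀ k, 0 ≤ ![a, b, c] k + t * g k := by
    intro k
    rcases lt_or_ge (g k) 0 with hk | hk
    · have := (le_div_iff₀ (by linarith)).1 (hmin k hk)
      linarith
    · exact add_nonneg (hpos k) (mul_nonneg ht0 hk)
  have hzero : ![a, b, c] j + t * g j = 0 := by
    have := div_mul_cancel₀ (![a, b, c] j) (neg_ne_zero.2 hj.ne)
    rw [← ht] at this
    linarith
  have hr : 0 ≤ -(t * (g 0 + g 1 + g 2)) := by nlinarith
  have h0 := hnn 0
  have h1 := hnn 1
  have h2 := hnn 2
  simp only [Matrix.cons_val] at h0 h1 h2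
  have hx : a • P + b • Q + c • S = (a + t * g 0) • P + (b + t * g 1) • Q + (c + t * g 2) • S +
      (-(t * (g 0 + g 1 + g 2))) • R := by
    have : t • (g 0 • (P - R) + g 1 • (Q - R) + g 2 • (S - R)) = 0 := by rw [hg0, smul_zero]
    rw [← sub_eq_zero, ← neg_eq_zero, ← this]
    module
  rw [hx]
  fin_cases j
  · right; right
    simp only [Fin.zero_eta, Matrix.cons_val] at hzero
    exact mem_convexHull_triple_iff.2 ⟨_, _, _, h1, hr, h2, by linarith, by rw [hzero]; module⟩
  · right; left
    simp only [Fin.mk_one, Matrix.cons_val] at hzero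
    exact mem_convexHull_triple_iff.2 ⟨_, _, _, h0, hr, h2, by linarith, by rw [hzero]; module⟩
  · left
    simp only [Fin.reduceFinMk, Matrix.cons_val] at hzero
    exact mem_convexHull_triple_iff.2 ⟨_, _, _, h0, h1, hr, by linarith, by rw [hzero]; module⟩

theorem symmDiff_convexHull_triple_subset (hE : Module.finrank ℝ E = 2) (P Q R S : E) :
    symmDiff (convexHull ℝ {P, Q, R}) (convexHull ℝ {P, Q, S}) ⊆
      convexHull ℝ {R, P, S} ∪ convexHull ℝ {R, Q, S} := by
  have h₁ := convexHull_triple_subset_union hE P Q R S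
  have h₂ := convexHull_triple_subset_union hE P Q S R
  rw [Set.pair_comm S R, Set.insert_comm P R, Set.insert_comm Q R] at h₂
  rw [Set.insert_comm P R, Set.insert_comm Q R] at h₁
  rintro x (⟨hx, hx'⟩ | ⟨hx, hx'⟩)
  · exact (h₂ hx).resolve_left hx'
  · exact (h₁ hx).resolve_left hx'

end ConvexHull

theorem volume_standard_triangle_le :
    volume {p : ℝ × ℝ | 0 ≤ p.1 ∧ 0 ≤ p.2 ∧ p.1 + p.2 ≤ 1} ≤ ENNReal.ofReal (1 / 2) := by
  have hmeas : MeasurableSet {p : ℝ × ℝ | 0 ≤ p.1 ∧ 0 ≤ p.2 ∧ p.1 + p.2 ≤ 1} := by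
    measurability
  rw [Measure.volume_eq_prod, Measure.prod_apply hmeas]
  calc
    _ ≤ ∫⁻ x, (Set.Icc (0 : ℝ) 1).indicator (fun x => ENNReal.ofReal (1 - x)) x := by
      refine lintegral_mono fun x => ?_
      by_cases hx : x ∈ Set.Icc (0 : ℝ) 1
      · rw [Set.indicator_of_mem hx]
        refine (measure_mono (t := Set.Icc 0 (1 - x)) ?_).trans (by simp)
        rintro y ⟨-, h1, h2⟩
        exact ⟨h1, by linarith⟩
      · rw [Set.indicator_of_notMem hx, nonpos_iff_eq_zero, ← nonpos_iff_eq_zero,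
          ← measure_empty (μ := (volume : Measure ℝ))]
        refine measure_mono ?_
        rintro y ⟨h0, h1, h2⟩
        simp only at h0 h1 h2
        exact hx ⟨h0, by linarith⟩
    _ = ENNReal.ofReal (∫ x in Set.Icc (0 : ℝ) 1, (1 - x)) := by
      rw [lintegral_indicator measurableSet_Icc, ofReal_integral_eq_lintegral_ofReal]
      · exact (by fun_prop : Continuous fun x : ℝ => 1 - x).integrableOn_Icc
      · filter_upwards [ae_restrict_mem measurableSet_Icc] with x hx
        simpa using hx.2
    _ = ENNReal.ofReal (1 / 2) := by
      rw [integral_Icc_eq_integral_Ioc, ← intervalIntegral.integral_of_le zero_le_one]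
      congr 1
      rw [intervalIntegral.integral_sub (by simp) (by simp)]
      norm_num

theorem volume_convexHull_triple_le (P Q R : EuclideanSpace ℝ (Fin 2)) :
    volume (convexHull ℝ {P, Q, R}) ≤ ENNReal.ofReal (dist P Q * dist P R / 2) := by
  let u := Q - P
  let v := R - P
  let f : EuclideanSpace ℝ (Fin 2) →ₗ[ℝ] EuclideanSpace ℝ (Fin 2) :=
    { toFun := fun x => x 0 • u + x 1 • v
      map_add' := fun x y => by simp only [PiLp.add_apply]; module
      map_smul' := fun c x => by
        simp only [PiLp.smul_apply, smul_eq_mul, RingHom.id_apply]; module }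
  have hdet : LinearMap.det f = u 0 * v 1 - v 0 * u 1 := by
    rw [← LinearMap.det_toMatrix (EuclideanSpace.basisFun (Fin 2) ℝ).toBasis, Matrix.det_fin_two]
    simp [LinearMap.toMatrix_apply, f]
  have hdet_le : |LinearMap.det f| ≤ dist P Q * dist P R := by
    rw [hdet, dist_comm P Q, dist_comm P R, dist_eq_norm, dist_eq_norm]
    change _ ≤ ‖u‖ * ‖v‖
    refine abs_le_of_sq_le_sq ?_ (by positivity)
    rw [mul_pow, EuclideanSpace.real_norm_sq_eq, EuclideanSpace.real_norm_sq_eq,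
      Fin.sum_univ_two, Fin.sum_univ_two]
    nlinarith [sq_nonneg (u 0 * v 0 + u 1 * v 1)]
  let T : Set (ℝ × ℝ) := {p | 0 ≤ p.1 ∧ 0 ≤ p.2 ∧ p.1 + p.2 ≤ 1}
  have hT : MeasurableSet T := by unfold T; measurability
  have he : MeasurePreserving (fun x : EuclideanSpace ℝ (Fin 2) => (x 0, x 1)) :=
    (volume_preserving_finTwoArrow ℝ).comp (PiLp.volume_preserving_ofLp (Fin 2))
  have hsub : convexHull ℝ {P, Q, R} ⊆
      (fun x => -P + x) ⁻¹' (f '' ((fun x : EuclideanSpace ℝ (Fin 2) => (x 0, x 1)) ⁻¹' T)) := by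
    intro x hx
    obtain ⟨a, b, c, ha, hb, hc, habc, rfl⟩ := mem_convexHull_triple_iff.1 hx
    refine ⟨!₂[b, c], ⟨hb, hc, ?_⟩, ?_⟩
    · simp; linarith
    · obtain rfl : a = 1 - b - c := by linarith
      simp only [f, u, v, LinearMap.coe_mk, AddHom.coe_mk, Matrix.cons_val]
      module
  calc
    _ ≤ _ := measure_mono hsub
    _ = ENNReal.ofReal |LinearMap.det f| * volume T := by
      rw [measure_preimage_add, Measure.addHaar_image_linearMap,
        he.measure_preimage hT.nullMeasurableSet]
    _ ≤ ENNReal.ofReal (dist P Q * dist P R) * ENNReal.ofReal (1 / 2) := by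
      gcongr
      exact volume_standard_triangle_le
    _ = _ := by
      rw [← ENNReal.ofReal_mul (by positivity)]
      ring_nf

/-- Moving one vertex of a triangle changes it by at most the area of the two swept triangles. -/
theorem volume_symmDiff_convexHull_triple_le (P Q R S : EuclideanSpace ℝ (Fin 2)) :
    volume (symmDiff (convexHull ℝ {P, Q, R}) (convexHull ℝ {P, Q, S})) ≤
      ENNReal.ofReal ((dist R P + dist R Q) * dist R S / 2) := by
  refine (measure_mono (symmDiff_convexHull_triple_subset (by simp) P Q R S)).trans ?_
  refine (measure_union_le _ _).trans ?_
  refine (add_le_add (volume_convexHull_triple_le R P S)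
    (volume_convexHull_triple_le R Q S)).trans ?_
  rw [← ENNReal.ofReal_add (by positivity) (by positivity)]
  exact ENNReal.ofReal_le_ofReal (by linarith)

/-- If `dist B B' ≤ δ`, `dist C C' ≤ δ` and `diam (conv{A,B,C}) ≤ D`, then the area of the
symmetric difference of the triangles `ABC` and `AB'C'` is at most `2δD + δ²`. -/
theorem triangle_symmDiff_area_le_of_close
    (A B C B' C' : EuclideanSpace ℝ (Fin 2)) (δ D : ℝ)
    (hδ : 0 ≤ δ) (hD : 0 ≤ D)
    (hB : dist B B' ≤ δ) (hC : dist C C' ≤ δ)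
    (hdiam : Metric.diam (convexHull ℝ {A, B, C}) ≤ D) :
    volume (symmDiff (convexHull ℝ {A, B, C}) (convexHull ℝ {A, B', C'})) ≤
      ENNReal.ofReal (2 * δ * D + δ ^ 2) := by
  have hbdd : Bornology.IsBounded ({A, B, C} : Set (EuclideanSpace ℝ (Fin 2))) :=
    (Set.toFinite _).isBounded
  rw [convexHull_diam] at hdiam
  have hBA : dist B A ≤ D := (dist_le_diam_of_mem hbdd (by simp) (by simp)).trans hdiam
  have hBC : dist B C ≤ D := (dist_le_diam_of_mem hbdd (by simp) (by simp)).trans hdiam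
  have hCA : dist C A ≤ D := (dist_le_diam_of_mem hbdd (by simp) (by simp)).trans hdiam
  have hCB' : dist C B' ≤ D + δ :=
    (dist_triangle C B B').trans (by rw [dist_comm C B]; exact add_le_add hBC hB)
  have h₁ := volume_symmDiff_convexHull_triple_le A C B B'
  rw [Set.pair_comm C B, Set.pair_comm C B'] at h₁
  have h₂ := volume_symmDiff_convexHull_triple_le A B' C C'
  refine (measure_symmDiff_le _ (convexHull ℝ {A, B', C}) _).trans ((add_le_add h₁ h₂).trans ?_)
  rw [← ENNReal.ofReal_add (by positivity) (by positivity)]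
  refine ENNReal.ofReal_le_ofReal ?_
  have e₁ : (dist B A + dist B C) * dist B B' ≤ (D + D) * δ := by gcongr
  have e₂ : (dist C A + dist C B') * dist C C' ≤ (D + (D + δ)) * δ := by gcongr
  nlinarith [sq_nonneg δ]
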